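/- arXiv:2305.08013 — 4 statements merged into one kernel-verified Lean document; each statement's English description precedes it below -/
import Mathlib

section
/- Let ξ : Ω → ℝ^{n'} be an absolutely continuous random vector and let f : ℝ^{n'} → ℝ^n be an injective piecewise-smooth mapping with Jacobian matrix J, where n ≥ n' and det(J(x)ᵀJ(x)) ≠ 0 for almost every x. Suppose either η is a discrete random variable or the pair (ξ, η) is an absolutely continuous random vector. Then I(ξ; η) = I(f(ξ); η), i.e., mutual information is invariant under such injective piecewise-smooth embeddings of one of the arguments. -/
open MeasureTheory ProbabilityTheory Matrix

/-- Differential entropy of the law `μ` relative to the reference measure `ν`: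
`h = -∫ log (dμ/dν) dμ` (natural logarithm). -/
noncomputable def dEnt {E : Type*} [MeasurableSpace E] (ν μ : Measure E) : ℝ :=
  -∫ x, Real.log ((μ.rnDeriv ν) x).toReal ∂μ

/-- The differential entropy of `μ` w.r.t. `ν` is (well-)defined. -/
def dEntDefined {E : Type*} [MeasurableSpace E] (ν μ : Measure E) : Prop :=
  μ ≪ ν ∧ Integrable (fun x => Real.log ((μ.rnDeriv ν) x).toReal) μ

/-- Mutual information `I(X;Y)`: the KL divergence of the joint law of `(X, Y)`
from the product of the marginal laws. -/
noncomputable def MI {Ω E F : Type*} [MeasurableSpace Ω] [MeasurableSpace E] [MeasurableSpace F]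
    (μ : Measure Ω) (X : Ω → E) (Y : Ω → F) : ℝ :=
  ∫ p, Real.log (((μ.map fun ω => (X ω, Y ω)).rnDeriv
      ((μ.map X).prod (μ.map Y))) p).toReal ∂(μ.map fun ω => (X ω, Y ω))

/-- `I(X;Y)` is (well-)defined. -/
def MIDefined {Ω E F : Type*} [MeasurableSpace Ω] [MeasurableSpace E] [MeasurableSpace F]
    (μ : Measure Ω) (X : Ω → E) (Y : Ω → F) : Prop :=
  (μ.map fun ω => (X ω, Y ω)) ≪ ((μ.map X).prod (μ.map Y)) ∧
    Integrable (fun p => Real.log (((μ.map fun ω => (X ω, Y ω)).rnDeriv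
      ((μ.map X).prod (μ.map Y))) p).toReal) (μ.map fun ω => (X ω, Y ω))

namespace MeasureTheory.Measure

/-- If `P ≪ ν`, then `ν` restricted to the set where the density of `P` does not vanish is
absolutely continuous with respect to `P`. -/
lemma restrict_rnDeriv_ne_zero_absolutelyContinuous {E : Type*} [MeasurableSpace E]
    {P ν : Measure E} [P.HaveLebesgueDecomposition ν] (h : P ≪ ν) :
    ν.restrict {x | P.rnDeriv ν x ≠ 0} ≪ P := by
  refine AbsolutelyContinuous.mk fun s hs hPs => ?_
  rw [← withDensity_rnDeriv_eq P ν h,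
    withDensity_apply_eq_zero (measurable_rnDeriv P ν)] at hPs
  rwa [restrict_apply hs, Set.inter_comm]

/-- A measure that is absolutely continuous with respect to some product measure is absolutely
continuous with respect to the product of its marginals. -/
lemma AbsolutelyContinuous.of_prod_prod_marginals {E F : Type*} [MeasurableSpace E]
    [MeasurableSpace F] {P : Measure (E × F)} [IsFiniteMeasure P] {ν₁ : Measure E}
    {ν₂ : Measure F} [SigmaFinite ν₁] [SigmaFinite ν₂] (h : P ≪ ν₁.prod ν₂) :
    P ≪ (P.map Prod.fst).prod (P.map Prod.snd) := by
  have h₁ : P.map Prod.fst ≪ ν₁ :=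
    (h.map measurable_fst).trans quasiMeasurePreserving_fst.absolutelyContinuous
  have h₂ : P.map Prod.snd ≪ ν₂ :=
    (h.map measurable_snd).trans quasiMeasurePreserving_snd.absolutelyContinuous
  have hprod := (restrict_rnDeriv_ne_zero_absolutelyContinuous h₁).prod
    (restrict_rnDeriv_ne_zero_absolutelyContinuous h₂)
  rw [prod_restrict] at hprod
  refine AbsolutelyContinuous.trans ?_ hprod
  have hP : P.restrict ({x | (P.map Prod.fst).rnDeriv ν₁ x ≠ 0} ×ˢ
      {y | (P.map Prod.snd).rnDeriv ν₂ y ≠ 0}) = P := by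
    refine restrict_eq_self_of_ae_mem ?_
    filter_upwards [ae_of_ae_map measurable_fst.aemeasurable (rnDeriv_pos h₁),
      ae_of_ae_map measurable_snd.aemeasurable (rnDeriv_pos h₂)] with p hp₁ hp₂
    exact ⟨hp₁.ne', hp₂.ne'⟩
  conv_lhs => rw [← hP]
  exact h.restrict _

/-- The joint law of two random variables, the second of which takes countably many values, is
absolutely continuous with respect to the product of the marginal laws. -/
lemma map_prodMk_absolutelyContinuous_of_countable_range {Ω E F : Type*} [MeasurableSpace Ω]
    [MeasurableSpace E] [MeasurableSpace F] [MeasurableSingletonClass F]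
    {μ : Measure Ω} [IsFiniteMeasure μ] {X : Ω → E} {Y : Ω → F} (hX : Measurable X)
    (hY : Measurable Y) (hc : (Set.range Y).Countable) :
    (μ.map fun ω => (X ω, Y ω)) ≪ (μ.map X).prod (μ.map Y) := by
  refine AbsolutelyContinuous.mk fun s hs hs0 => ?_
  rw [map_apply (hX.prodMk hY) hs]
  have hsub : (fun ω => (X ω, Y ω)) ⁻¹' s ⊆
      ⋃ y ∈ Set.range Y, X ⁻¹' ((fun x => (x, y)) ⁻¹' s) ∩ Y ⁻¹' {y} := fun ω hω =>
    Set.mem_biUnion ⟨ω, rfl⟩ ⟨hω, rfl⟩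
  refine measure_mono_null hsub ((measure_biUnion_null_iff hc).2 fun y _ => ?_)
  have hrect : ((fun x => (x, y)) ⁻¹' s) ×ˢ {y} ⊆ s := by
    rintro ⟨x, z⟩ ⟨hx, rfl⟩
    exact hx
  have hzero := measure_mono_null hrect hs0
  rw [prod_prod, mul_eq_zero, map_apply hX (measurable_prodMk_right hs),
    map_apply hY (measurableSet_singleton y)] at hzero
  exact hzero.elim (measure_mono_null Set.inter_subset_left)
    (measure_mono_null Set.inter_subset_right)

end MeasureTheory.Measure

/-- The expected log-likelihood ratio is invariant under pushing both measures forward along a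
measurable embedding. -/
lemma MeasurableEmbedding.integral_log_rnDeriv_map {E F : Type*} [MeasurableSpace E]
    [MeasurableSpace F] {g : E → F} (hg : MeasurableEmbedding g) {P Q : Measure E}
    [SigmaFinite P] [SigmaFinite Q] (hPQ : P ≪ Q) :
    ∫ y, Real.log (((P.map g).rnDeriv (Q.map g)) y).toReal ∂(P.map g) =
      ∫ x, Real.log ((P.rnDeriv Q) x).toReal ∂P := by
  rw [hg.integral_map]
  refine integral_congr_ae ?_
  filter_upwards [hPQ.ae_le (hg.rnDeriv_map P Q)] with x hx
  rw [hx]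

/-- Mutual information is invariant under a measurable embedding of the first argument, provided
the joint law is absolutely continuous with respect to the product of the marginal laws. -/
lemma MI_comp_left_of_measurableEmbedding {Ω E E' F : Type*} [MeasurableSpace Ω]
    [MeasurableSpace E] [MeasurableSpace E'] [MeasurableSpace F] {μ : Measure Ω}
    [IsFiniteMeasure μ] {X : Ω → E} {Y : Ω → F} {f : E → E'} (hX : Measurable X)
    (hY : Measurable Y) (hf : MeasurableEmbedding f)
    (hac : (μ.map fun ω => (X ω, Y ω)) ≪ (μ.map X).prod (μ.map Y)) :
    MI μ (fun ω => f (X ω)) Y = MI μ X Y := by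
  have hjoint : (μ.map fun ω => (f (X ω), Y ω)) =
      (μ.map fun ω => (X ω, Y ω)).map (Prod.map f id) :=
    (Measure.map_map (hf.measurable.prodMap measurable_id) (hX.prodMk hY)).symm
  have hmarg : (μ.map fun ω => f (X ω)).prod (μ.map Y) =
      ((μ.map X).prod (μ.map Y)).map (Prod.map f id) := by
    rw [← Measure.map_prod_map _ _ hf.measurable measurable_id, Measure.map_id,
      Measure.map_map hf.measurable hX, Function.comp_def]
  unfold MI
  rw [hjoint, hmarg]
  exact (hf.prodMap MeasurableEmbedding.id).integral_log_rnDeriv_map hac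

/-- Mutual information is invariant under an injective piecewise-smooth
embedding `f : ℝ^{n'} → ℝ^n` (with `n ≥ n'` and a.e. nonsingular Jacobian `J`, i.e.
`det(JᵀJ) ≠ 0` a.e.) of the absolutely continuous argument `ξ`, provided that either
`η` is discrete or `(ξ, η)` is absolutely continuous: `I(ξ; η) = I(f(ξ); η)`. -/
theorem mi_invariant_under_injective_piecewise_smooth_embedding
    {Ω : Type*} [MeasurableSpace Ω] (μ : Measure Ω) [IsProbabilityMeasure μ]
    {n' n m : ℕ} (hn : n' ≤ n)
    (ξ : Ω → Fin n' → ℝ) (η : Ω → Fin m → ℝ)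
    (hξ : Measurable ξ) (hη : Measurable η)
    -- `ξ` is absolutely continuous:
    (hξac : μ.map ξ ≪ (volume : Measure (Fin n' → ℝ)))
    (f : (Fin n' → ℝ) → (Fin n → ℝ)) (hfmeas : Measurable f)
    (hfinj : Function.Injective f)
    -- `f` is piecewise smooth with Jacobian matrix `J`:
    (J : (Fin n' → ℝ) → Matrix (Fin n) (Fin n') ℝ)
    (hdiff : ∀ᵐ x ∂(volume : Measure (Fin n' → ℝ)),
      HasFDerivAt f (Matrix.toLin' (J x)).toContinuousLinearMap x)
    -- `det (JᵀJ) ≠ 0` almost everywhere: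
    (hdet : ∀ᵐ x ∂(volume : Measure (Fin n' → ℝ)), ((J x)ᵀ * J x).det ≠ 0)
    -- either `η` is discrete, or `(ξ, η)` is absolutely continuous:
    (hcase : (Set.range η).Countable ∨
      (μ.map fun ω => (ξ ω, η ω)) ≪ (volume : Measure ((Fin n' → ℝ) × (Fin m → ℝ)))) :
    MI μ ξ η = MI μ (fun ω => f (ξ ω)) η := by
  refine (MI_comp_left_of_measurableEmbedding hξ hη (hfmeas.measurableEmbedding hfinj) ?_).symm
  rcases hcase with hc | hac
  · exact Measure.map_prodMk_absolutelyContinuous_of_countable_range hξ hη hc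
  · have hmarg := Measure.AbsolutelyContinuous.of_prod_prod_marginals hac
    rwa [Measure.map_map measurable_fst (hξ.prodMk hη),
      Measure.map_map measurable_snd (hξ.prodMk hη)] at hmarg
end

section
/- Let X : Ω → ℝ^n be a random vector and E : ℝ^n → ℝ^{n'} an encoder such that E(X) is an absolutely continuous random vector, an inverse map E⁻¹ : E(supp X) → ℝ^n exists with (E⁻¹ ∘ E)(X) ≡ X, and E⁻¹ is an injective piecewise-smooth mapping whose Jacobian J satisfies det(JᵀJ) ≠ 0 almost everywhere, while Y is either discrete or makes (E(X), Y) absolutely continuous. Then I(X; Y) = I(E(X); Y): mutual information is preserved under lossless compression by the encoder E. -/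
open MeasureTheory ProbabilityTheory Matrix

/-- A `σ`-finite measure `ρ` is concentrated on a measurable set on which another `σ`-finite
measure `γ` is absolutely continuous with respect to `ρ`. -/
theorem exists_measurableSet_compl_null_restrict_absolutelyContinuous {G : Type*}
    [MeasurableSpace G] (ρ γ : Measure G) [SigmaFinite ρ] [SigmaFinite γ] :
    ∃ A, MeasurableSet A ∧ ρ Aᶜ = 0 ∧ γ.restrict A ≪ ρ := by
  obtain ⟨A, hA, hsing, hρ⟩ := Measure.mutuallySingular_singularPart γ ρ
  refine ⟨A, hA, hρ, ?_⟩
  rw [γ.haveLebesgueDecomposition_add ρ, Measure.restrict_add,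
    Measure.restrict_eq_zero.2 hsing, zero_add]
  exact Measure.restrict_le_self.absolutelyContinuous.trans
    (withDensity_absolutelyContinuous _ _)

/-- A finite measure on a product that is absolutely continuous with respect to a product of
`σ`-finite measures is absolutely continuous with respect to the product of its marginals. -/
theorem absolutelyContinuous_prod_fst_snd {E F : Type*} [MeasurableSpace E] [MeasurableSpace F]
    {π : Measure (E × F)} [IsFiniteMeasure π] {α : Measure E} {β : Measure F}
    [SigmaFinite α] [SigmaFinite β] (h : π ≪ α.prod β) : π ≪ π.fst.prod π.snd := by
  obtain ⟨A, hA, hA0, hAac⟩ :=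
    exists_measurableSet_compl_null_restrict_absolutelyContinuous π.fst α
  obtain ⟨B, hB, hB0, hBac⟩ :=
    exists_measurableSet_compl_null_restrict_absolutelyContinuous π.snd β
  rw [Measure.fst_apply hA.compl] at hA0
  rw [Measure.snd_apply hB.compl] at hB0
  have hAB : ∀ᵐ p ∂π, p ∈ A ×ˢ B := by
    filter_upwards [measure_eq_zero_iff_ae_notMem.1 hA0, measure_eq_zero_iff_ae_notMem.1 hB0]
      with p hpA hpB
    exact ⟨not_not.1 hpA, not_not.1 hpB⟩
  rw [← Measure.restrict_eq_self_of_ae_mem hAB]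
  refine (h.restrict _).trans ?_
  rw [← Measure.prod_restrict, Measure.restrict_eq_self_of_ae_mem hAB]
  exact hAac.prod hBac

/-- The joint law of two random variables, one of which has countable range, is absolutely
continuous with respect to the product of the marginal laws. -/
theorem map_prodMk_absolutelyContinuous_of_countable_range {Ω E F : Type*} [MeasurableSpace Ω]
    [MeasurableSpace E] [MeasurableSpace F] [MeasurableSingletonClass F] {μ : Measure Ω}
    [IsFiniteMeasure μ] {Z : Ω → E} {Y : Ω → F} (hZ : Measurable Z) (hY : Measurable Y)
    (hc : (Set.range Y).Countable) :
    μ.map (fun ω => (Z ω, Y ω)) ≪ (μ.map Z).prod (μ.map Y) := by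
  refine Measure.AbsolutelyContinuous.mk fun s hs h0 => ?_
  rw [Measure.map_apply (hZ.prodMk hY) hs]
  have hsub : (fun ω => (Z ω, Y ω)) ⁻¹' s ⊆
      ⋃ y ∈ Set.range Y, Z ⁻¹' ((fun z => (z, y)) ⁻¹' s) ∩ Y ⁻¹' {y} := by
    intro ω hω
    simp only [Set.mem_iUnion]
    exact ⟨Y ω, ⟨ω, rfl⟩, hω, rfl⟩
  refine measure_mono_null hsub ((measure_biUnion_null_iff hc).2 fun y _ => ?_)
  have hsy : MeasurableSet ((fun z : E => (z, y)) ⁻¹' s) := measurable_prodMk_right hs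
  have hrect : ((fun z : E => (z, y)) ⁻¹' s) ×ˢ {y} ⊆ s := by
    rintro ⟨z, y'⟩ ⟨hz, rfl⟩
    exact hz
  have hmul := measure_mono_null hrect h0
  rw [Measure.prod_prod, mul_eq_zero, Measure.map_apply hZ hsy,
    Measure.map_apply hY (measurableSet_singleton y)] at hmul
  rcases hmul with h | h
  · exact measure_mono_null Set.inter_subset_left h
  · exact measure_mono_null Set.inter_subset_right h

/-- Mutual information is invariant under applying a measurable embedding to the first variable. -/
theorem MI_measurableEmbedding_comp {Ω E E' F : Type*} [MeasurableSpace Ω] [MeasurableSpace E]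
    [MeasurableSpace E'] [MeasurableSpace F] {μ : Measure Ω} [IsFiniteMeasure μ]
    {f : E → E'} (hf : MeasurableEmbedding f) {Z : Ω → E} {Y : Ω → F}
    (hZ : Measurable Z) (hY : Measurable Y)
    (hac : μ.map (fun ω => (Z ω, Y ω)) ≪ (μ.map Z).prod (μ.map Y)) :
    MI μ (fun ω => f (Z ω)) Y = MI μ Z Y := by
  have hg : MeasurableEmbedding (Prod.map f (id : F → F)) := hf.prodMap .id
  have hjoint : μ.map (fun ω => (f (Z ω), Y ω)) =
      (μ.map fun ω => (Z ω, Y ω)).map (Prod.map f id) :=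
    (Measure.map_map hg.measurable (hZ.prodMk hY)).symm
  have hprod : (μ.map fun ω => f (Z ω)).prod (μ.map Y) =
      ((μ.map Z).prod (μ.map Y)).map (Prod.map f id) := by
    rw [← Measure.map_prod_map _ _ hf.measurable measurable_id, Measure.map_id,
      Measure.map_map hf.measurable hZ]
    rfl
  unfold MI
  rw [hjoint, hprod, hg.integral_map]
  refine integral_congr_ae ?_
  filter_upwards [hac.ae_le (hg.rnDeriv_map (μ.map fun ω => (Z ω, Y ω))
    ((μ.map Z).prod (μ.map Y)))] with p hp
  rw [hp]

/-- (Corollary: MI under lossless compression.) Let `X` be a random vector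
in `ℝ^n` and `Enc : ℝ^n → ℝ^{n'}` an encoder such that `Enc(X)` is absolutely continuous,
an inverse `Einv : Enc(supp X) → ℝ^n` exists with `Einv ∘ Enc ∘ X ≡ X`, and `Einv` is an
injective piecewise-smooth map whose Jacobian `J` satisfies `det(JᵀJ) ≠ 0` a.e.; suppose
`Y` is either discrete or `(Enc(X), Y)` is absolutely continuous. Then
`I(X; Y) = I(Enc(X); Y)`. -/
theorem mi_eq_mi_of_lossless_compression
    {Ω : Type*} [MeasurableSpace Ω] (μ : Measure Ω) [IsProbabilityMeasure μ]
    {n n' m : ℕ} (hn : n' ≤ n)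
    (X : Ω → Fin n → ℝ) (Y : Ω → Fin m → ℝ)
    (hX : Measurable X) (hY : Measurable Y)
    (Enc : (Fin n → ℝ) → (Fin n' → ℝ)) (hEnc : Measurable Enc)
    -- `E(X)` is absolutely continuous:
    (hEXac : μ.map (fun ω => Enc (X ω)) ≪ (volume : Measure (Fin n' → ℝ)))
    -- the inverse map `E⁻¹`, defined (at least) on `E(supp X)`:
    (Einv : (Fin n' → ℝ) → (Fin n → ℝ)) (hEinvMeas : Measurable Einv)
    -- `(E⁻¹ ∘ E)(X) ≡ X`:
    (hinv : ∀ ω, Einv (Enc (X ω)) = X ω)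
    -- `E⁻¹` is injective and piecewise smooth with a.e. nonsingular Jacobian `J`:
    (hEinvInj : Function.Injective Einv)
    (J : (Fin n' → ℝ) → Matrix (Fin n) (Fin n') ℝ)
    (hdiff : ∀ᵐ x ∂(volume : Measure (Fin n' → ℝ)),
      HasFDerivAt Einv (Matrix.toLin' (J x)).toContinuousLinearMap x)
    (hdet : ∀ᵐ x ∂(volume : Measure (Fin n' → ℝ)), ((J x)ᵀ * J x).det ≠ 0)
    -- either `Y` is discrete, or `(E(X), Y)` is absolutely continuous:
    (hcase : (Set.range Y).Countable ∨
      (μ.map fun ω => (Enc (X ω), Y ω)) ≪ (volume : Measure ((Fin n' → ℝ) × (Fin m → ℝ)))) :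
    MI μ X Y = MI μ (fun ω => Enc (X ω)) Y := by
  have hEmb := hEinvMeas.measurableEmbedding hEinvInj
  have hZ : Measurable fun ω => Enc (X ω) := hEnc.comp hX
  have hac : μ.map (fun ω => (Enc (X ω), Y ω)) ≪
      (μ.map fun ω => Enc (X ω)).prod (μ.map Y) := by
    rcases hcase with hc | hc
    · exact map_prodMk_absolutelyContinuous_of_countable_range hZ hY hc
    · have := absolutelyContinuous_prod_fst_snd hc
      rwa [Measure.fst_map_prodMk hY, Measure.snd_map_prodMk hZ] at this
  have h := MI_measurableEmbedding_comp hEmb hZ hY hac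
  simpa only [hinv] using h
end

section
/- For every κ ≥ 0 there exist random vectors X : Ω → ℝ^n, Y : Ω → ℝ^m and a non-trivial linear autoencoder A = D ∘ E with latent space dimension n' < n that is optimal among linear autoencoders of latent dimension n' in the sense of minimizing the mean squared reconstruction error E‖X − A(X)‖², such that I(X; Y) = κ while I(E(X); Y) = 0. In particular, one may take n = 2, m = 1, n' = 1, X = (X₁, X₂) Gaussian with independent components of variances 1 and σ < 1, Y standard Gaussian with Cov(X₂, Y) = sqrt(1 − e^{−2κ}) and Cov(X₁, Y) = 0, and E the projection onto the first principal component, E(X) = X₁. -/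
open MeasureTheory ProbabilityTheory Matrix

/-- If the joint law of `(X, Y)` under `μ` has density `F` with respect to a law under which `X` and
`Y` are independent with the same marginals, then `MI μ X Y` is the mean of `log F`. -/
lemma MI_withDensity {Ω E F : Type*} [MeasurableSpace Ω] [MeasurableSpace E] [MeasurableSpace F]
    {π : Measure Ω} [IsProbabilityMeasure π] {X : Ω → E} {Y : Ω → F} (hX : Measurable X)
    (hY : Measurable Y) (hXY : IndepFun X Y π) {f : E × F → ENNReal} (hf : Measurable f)
    (hmX : (π.withDensity fun ω => f (X ω, Y ω)).map X = π.map X)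
    (hmY : (π.withDensity fun ω => f (X ω, Y ω)).map Y = π.map Y) :
    MI (π.withDensity fun ω => f (X ω, Y ω)) X Y =
      ∫ ω, Real.log (f (X ω, Y ω)).toReal ∂(π.withDensity fun ω => f (X ω, Y ω)) := by
  have hXYm : Measurable fun ω => (X ω, Y ω) := hX.prodMk hY
  have := Measure.isProbabilityMeasure_map (μ := π) hX.aemeasurable
  have := Measure.isProbabilityMeasure_map (μ := π) hY.aemeasurable
  have hjoint : (π.withDensity fun ω => f (X ω, Y ω)).map (fun ω => (X ω, Y ω)) =
      ((π.map X).prod (π.map Y)).withDensity f := by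
    rw [← (indepFun_iff_map_prod_eq_prod_map_map hX.aemeasurable hY.aemeasurable).1 hXY]
    ext s hs
    rw [Measure.map_apply hXYm hs, withDensity_apply _ (hXYm hs), withDensity_apply _ hs,
      setLIntegral_map hs hf hXYm]
  have hlog : ∀ᵐ p ∂((π.map X).prod (π.map Y)).withDensity f,
      Real.log (((((π.map X).prod (π.map Y)).withDensity f).rnDeriv
        ((π.map X).prod (π.map Y))) p).toReal = Real.log (f p).toReal := by
    filter_upwards [(withDensity_absolutelyContinuous _ _).ae_le
      (Measure.rnDeriv_withDensity ((π.map X).prod (π.map Y)) hf)] with p hp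
    rw [hp]
  unfold MI
  rw [hmX, hmY, hjoint, integral_congr_ae hlog, ← hjoint, integral_map hXYm.aemeasurable]
  exact (Real.measurable_log.comp hf.ennreal_toReal).aestronglyMeasurable

lemma MI_eq_zero_of_indepFun {Ω E F : Type*} [MeasurableSpace Ω] [MeasurableSpace E]
    [MeasurableSpace F] {μ : Measure Ω} [IsProbabilityMeasure μ] {X : Ω → E} {Y : Ω → F}
    (hX : Measurable X) (hY : Measurable Y) (hXY : IndepFun X Y μ) : MI μ X Y = 0 := by
  have h := MI_withDensity hX hY hXY (f := fun _ => 1) measurable_const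
  simpa using h

lemma map_fst_withDensity_prod {α β : Type*} [MeasurableSpace α] [MeasurableSpace β]
    {μ : Measure α} {ν : Measure β} [SFinite μ] [SFinite ν] {f : α × β → ENNReal}
    (hf : Measurable f) (h : ∀ x, ∫⁻ y, f (x, y) ∂ν = 1) :
    ((μ.prod ν).withDensity f).map Prod.fst = μ := by
  refine Measure.ext_of_lintegral _ fun g hg => ?_
  rw [lintegral_map hg measurable_fst,
    lintegral_withDensity_eq_lintegral_mul _ hf (g := fun p => g p.1) (by fun_prop),
    lintegral_prod _ (by fun_prop)]
  refine lintegral_congr fun x => ?_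
  simp only [Pi.mul_apply]
  rw [lintegral_mul_const _ (by fun_prop), h, one_mul]

lemma map_snd_withDensity_prod {α β : Type*} [MeasurableSpace α] [MeasurableSpace β]
    {μ : Measure α} {ν : Measure β} [SFinite μ] [SFinite ν] {f : α × β → ENNReal}
    (hf : Measurable f) (h : ∀ y, ∫⁻ x, f (x, y) ∂μ = 1) :
    ((μ.prod ν).withDensity f).map Prod.snd = ν := by
  refine Measure.ext_of_lintegral _ fun g hg => ?_
  rw [lintegral_map hg measurable_snd,
    lintegral_withDensity_eq_lintegral_mul _ hf (g := fun p => g p.2) (by fun_prop),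
    lintegral_prod_symm _ (by fun_prop)]
  refine lintegral_congr fun y => ?_
  simp only [Pi.mul_apply]
  rw [lintegral_mul_const _ (by fun_prop), h, one_mul]

/-- The logarithm of the density, with respect to the standard Gaussian measure on the plane, of
the centred Gaussian law with unit variances and correlation `√(1 - exp (-2κ))`. -/
noncomputable def gaussianLogDensity (κ x y : ℝ) : ℝ :=
  κ + (x ^ 2 - (x - √(1 - Real.exp (-2 * κ)) * y) ^ 2 / Real.exp (-2 * κ)) / 2

@[fun_prop]
lemma measurable_gaussianLogDensity (κ : ℝ) :
    Measurable fun p : ℝ × ℝ => gaussianLogDensity κ p.1 p.2 := by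
  unfold gaussianLogDensity
  fun_prop

lemma sq_sqrt_one_sub_exp {κ : ℝ} (hκ : 0 ≤ κ) :
    √(1 - Real.exp (-2 * κ)) ^ 2 = 1 - Real.exp (-2 * κ) :=
  Real.sq_sqrt (sub_nonneg.2 (Real.exp_le_one_iff.2 (by linarith)))

lemma gaussianLogDensity_comm {κ : ℝ} (hκ : 0 ≤ κ) (x y : ℝ) :
    gaussianLogDensity κ x y = gaussianLogDensity κ y x := by
  have h := sq_sqrt_one_sub_exp hκ
  have hv := Real.exp_ne_zero (-2 * κ)
  unfold gaussianLogDensity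
  generalize √(1 - Real.exp (-2 * κ)) = r at *
  generalize Real.exp (-2 * κ) = v at *
  field_simp
  linear_combination (x ^ 2 - y ^ 2) * h

/-- Reweighting the standard Gaussian by the conditional density yields a Gaussian. -/
lemma gaussianReal_withDensity_exp_gaussianLogDensity (κ y : ℝ) :
    (gaussianReal 0 1).withDensity
        (fun x => ENNReal.ofReal (Real.exp (gaussianLogDensity κ x y))) =
      gaussianReal (√(1 - Real.exp (-2 * κ)) * y) (Real.exp (-2 * κ)).toNNReal := by
  have hv : (Real.exp (-2 * κ)).toNNReal ≠ 0 := by simp [Real.exp_pos]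
  rw [gaussianReal_of_var_ne_zero _ one_ne_zero, gaussianReal_of_var_ne_zero _ hv,
    ← withDensity_mul _ (measurable_gaussianPDF _ _) (by unfold gaussianLogDensity; fun_prop)]
  congr 1
  ext x
  simp only [Pi.mul_apply, gaussianPDF]
  rw [← ENNReal.ofReal_mul (gaussianPDFReal_nonneg _ _ _)]
  congr 1
  simp only [gaussianPDFReal, gaussianLogDensity, Real.coe_toNNReal _ (Real.exp_pos _).le,
    NNReal.coe_one, mul_one]
  have hs : √(Real.exp (-2 * κ)) = Real.exp (-κ) := by
    rw [show -2 * κ = -κ + -κ by ring, Real.exp_add, Real.sqrt_mul_self (Real.exp_pos _).le]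
  rw [Real.sqrt_mul (by positivity) (Real.exp _), hs, mul_inv, ← Real.exp_neg, neg_neg, mul_assoc,
    mul_assoc, ← Real.exp_add, ← Real.exp_add]
  congr 2
  have := Real.exp_ne_zero (-2 * κ)
  field_simp
  ring

lemma lintegral_exp_gaussianLogDensity (κ y : ℝ) :
    ∫⁻ x, ENNReal.ofReal (Real.exp (gaussianLogDensity κ x y)) ∂gaussianReal 0 1 = 1 := by
  have h := congrArg (fun m => m Set.univ) (gaussianReal_withDensity_exp_gaussianLogDensity κ y)
  simpa using h

lemma integral_exp_gaussianLogDensity_mul (κ y : ℝ) :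
    ∫ x, Real.exp (gaussianLogDensity κ x y) * x ∂gaussianReal 0 1 =
      √(1 - Real.exp (-2 * κ)) * y := by
  rw [← integral_id_gaussianReal (μ := √(1 - Real.exp (-2 * κ)) * y)
    (v := (Real.exp (-2 * κ)).toNNReal), ← gaussianReal_withDensity_exp_gaussianLogDensity,
    integral_withDensity_eq_integral_toReal_smul (by unfold gaussianLogDensity; fun_prop) (by simp)]
  simp [ENNReal.toReal_ofReal, (Real.exp_pos _).le]

/-- The best rank-one linear reconstruction of uncorrelated coordinates `(U, V / 2)`, with `U` and
`V` of unit second moment, has mean squared error at least `1 / 4`. -/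
lemma quarter_le_integral_rank_one_error {Ω : Type*} [MeasurableSpace Ω] {μ : Measure Ω}
    {U V : Ω → ℝ} (hU : MemLp U 2 μ) (hV : MemLp V 2 μ) (hUU : ∫ ω, U ω ^ 2 ∂μ = 1)
    (hVV : ∫ ω, V ω ^ 2 ∂μ = 1) (hUV : ∫ ω, U ω * V ω ∂μ = 0)
    (Enc : EuclideanSpace ℝ (Fin 2) →ₗ[ℝ] EuclideanSpace ℝ (Fin 1))
    (Dec : EuclideanSpace ℝ (Fin 1) →ₗ[ℝ] EuclideanSpace ℝ (Fin 2)) :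
    1 / 4 ≤ ∫ ω, ‖!₂[U ω, V ω / 2] - Dec (Enc !₂[U ω, V ω / 2])‖ ^ 2 ∂μ := by
  set w := Dec !₂[1]
  set α := Enc !₂[1, 0] 0 with hα
  set β := Enc !₂[0, 1] 0 with hβ
  have hrec : ∀ x y : ℝ, Dec (Enc !₂[x, y]) = (x * α + y * β) • w := by
    intro x y
    have h1 : (!₂[x, y] : EuclideanSpace ℝ (Fin 2)) = x • !₂[1, 0] + y • !₂[0, 1] := by
      ext i; fin_cases i <;> simp
    have h2 : Enc !₂[x, y] = (x * α + y * β) • !₂[1] := by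
      ext i; fin_cases i; simp [h1, hα, hβ]
    rw [h2, map_smul]
  have hnorm : ∀ ω, ‖!₂[U ω, V ω / 2] - Dec (Enc !₂[U ω, V ω / 2])‖ ^ 2 =
      (U ω - (U ω * α + V ω / 2 * β) * w 0) ^ 2 +
        (V ω / 2 - (U ω * α + V ω / 2 * β) * w 1) ^ 2 := by
    intro ω
    rw [EuclideanSpace.real_norm_sq_eq, hrec]
    simp [Fin.sum_univ_two]
  obtain ⟨a, b, hab, hperp⟩ : ∃ a b : ℝ, a ^ 2 + b ^ 2 = 1 ∧ a * w 0 + b * w 1 = 0 := by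
    by_cases h : w 0 ^ 2 + w 1 ^ 2 = 0
    · exact ⟨0, 1, by norm_num, by nlinarith [sq_nonneg (w 0), sq_nonneg (w 1)]⟩
    · have hs : √(w 0 ^ 2 + w 1 ^ 2) ^ 2 = w 0 ^ 2 + w 1 ^ 2 := Real.sq_sqrt (by positivity)
      have hs0 : √(w 0 ^ 2 + w 1 ^ 2) ≠ 0 := fun h0 => h (by rw [← hs, h0]; ring)
      refine ⟨-w 1 / √(w 0 ^ 2 + w 1 ^ 2), w 0 / √(w 0 ^ 2 + w 1 ^ 2), ?_, by ring⟩
      field_simp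
      linarith
  have hUi := hU.integrable_sq
  have hVi := hV.integrable_sq
  have hUVi : Integrable (fun ω => U ω * V ω) μ := hU.integrable_mul hV
  have hquad : Integrable (fun ω => a ^ 2 * U ω ^ 2 + b ^ 2 / 4 * V ω ^ 2) μ :=
    (hUi.const_mul _).add (hVi.const_mul _)
  calc (1 : ℝ) / 4 ≤ a ^ 2 + b ^ 2 / 4 := by nlinarith [sq_nonneg a]
    _ = ∫ ω, (a ^ 2 * U ω ^ 2 + b ^ 2 / 4 * V ω ^ 2) + a * b * (U ω * V ω) ∂μ := by
      rw [integral_add hquad (hUVi.const_mul _),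
        integral_add (hUi.const_mul _) (hVi.const_mul _)]
      simp only [integral_const_mul, hUU, hVV, hUV]
      ring
    _ ≤ _ := by
      simp only [hnorm]
      refine integral_mono (hquad.add (hUVi.const_mul _)) ?_ ?_
      · have hlin : ∀ s t : ℝ, MemLp (fun ω => s * U ω + t * V ω) 2 μ := fun s t =>
          (hU.const_mul s).add (hV.const_mul t)
        refine Integrable.add ?_ ?_
        · exact (hlin (1 - α * w 0) (-(β * w 0 / 2))).integrable_sq.congr
            (.of_forall fun ω => by dsimp only; ring)
        · exact (hlin (-(α * w 1)) (1 / 2 - β * w 1 / 2)).integrable_sq.congr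
            (.of_forall fun ω => by dsimp only; ring)
      · intro ω
        dsimp only
        set c := U ω * α + V ω / 2 * β
        have hu : a * U ω + b * (V ω / 2) =
            a * (U ω - c * w 0) + b * (V ω / 2 - c * w 1) := by
          linear_combination c * hperp
        have hcs : (a * (U ω - c * w 0) + b * (V ω / 2 - c * w 1)) ^ 2 ≤
            (U ω - c * w 0) ^ 2 + (V ω / 2 - c * w 1) ^ 2 := by
          have := sq_nonneg (b * (U ω - c * w 0) - a * (V ω / 2 - c * w 1))
          linear_combination this + ((U ω - c * w 0) ^ 2 + (V ω / 2 - c * w 1) ^ 2) * hab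
        rw [← hu] at hcs
        linarith

/-- For every `κ ≥ 0` there exist random vectors `X : Ω → ℝ^n`,
`Y : Ω → ℝ^m` and a non-trivial linear autoencoder `A = D ∘ E` with latent dimension
`n' < n` which is optimal among all linear autoencoders of latent dimension `n'` in the
sense of minimizing the mean squared reconstruction error `E‖X − A(X)‖²`, such that
`I(X; Y) = κ` while `I(E(X); Y) = 0`. -/
theorem exists_mse_optimal_linear_autoencoder_killing_mutual_information
    (κ : ℝ) (hκ : 0 ≤ κ) :
    ∃ (n m n' : ℕ), n' < n ∧
      ∃ (Ω : Type) (_ : MeasurableSpace Ω) (μ : Measure Ω),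
        IsProbabilityMeasure μ ∧
        ∃ (X : Ω → EuclideanSpace ℝ (Fin n)) (Y : Ω → EuclideanSpace ℝ (Fin m))
          (Enc : EuclideanSpace ℝ (Fin n) →ₗ[ℝ] EuclideanSpace ℝ (Fin n'))
          (Dec : EuclideanSpace ℝ (Fin n') →ₗ[ℝ] EuclideanSpace ℝ (Fin n)),
          Measurable X ∧ Measurable Y ∧
          -- the autoencoder `A = D ∘ E` is non-trivial:
          Dec ∘ₗ Enc ≠ 0 ∧
          -- `A = D ∘ E` minimizes the mean squared error `E‖X − A(X)‖²` among all
          -- linear autoencoders with latent space dimension `n'`: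
          (∀ (Enc' : EuclideanSpace ℝ (Fin n) →ₗ[ℝ] EuclideanSpace ℝ (Fin n'))
             (Dec' : EuclideanSpace ℝ (Fin n') →ₗ[ℝ] EuclideanSpace ℝ (Fin n)),
            (∫ ω, ‖X ω - Dec (Enc (X ω))‖ ^ 2 ∂μ)
              ≤ ∫ ω, ‖X ω - Dec' (Enc' (X ω))‖ ^ 2 ∂μ) ∧
          MI μ X Y = κ ∧
          MI μ (fun ω => Enc (X ω)) Y = 0 := by
  set γ : Measure ℝ := gaussianReal 0 1 with hγ
  set π : Measure ((ℝ × ℝ) × ℝ) := (γ.prod γ).prod γ with hπ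
  set f : (ℝ × ℝ) × ℝ → ENNReal :=
    fun ω => ENNReal.ofReal (Real.exp (gaussianLogDensity κ ω.1.2 ω.2)) with hf_def
  set μ := π.withDensity f with hμ
  have hf : Measurable f := by
    have : Measurable fun ω : (ℝ × ℝ) × ℝ => gaussianLogDensity κ ω.1.2 ω.2 :=
      (measurable_gaussianLogDensity κ).comp (by fun_prop : Measurable fun ω : (ℝ × ℝ) × ℝ =>
        (ω.1.2, ω.2))
    fun_prop
  have hfst : μ.map Prod.fst = γ.prod γ := by
    refine map_fst_withDensity_prod hf fun x => ?_
    simp only [hf_def, gaussianLogDensity_comm hκ x.2]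
    exact lintegral_exp_gaussianLogDensity κ x.2
  have hfiber : ∀ y x₁ : ℝ, ∫⁻ x₂, f ((x₁, x₂), y) ∂γ = 1 := fun y _ =>
    lintegral_exp_gaussianLogDensity κ y
  have hsnd : μ.map Prod.snd = γ := by
    refine map_snd_withDensity_prod hf fun y => ?_
    rw [lintegral_prod _ (by fun_prop)]
    simp [hfiber]
  have hprob : IsProbabilityMeasure μ := by
    have : IsProbabilityMeasure (μ.map Prod.snd) := by rw [hsnd]; infer_instance
    exact Measure.isProbabilityMeasure_of_map Prod.snd
  have hjoint : μ.map (fun ω => (ω.1.1, ω.2)) = γ.prod γ := by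
    refine Measure.ext_of_lintegral _ fun g hg => ?_
    have hg' : Measurable fun ω : (ℝ × ℝ) × ℝ => g (ω.1.1, ω.2) := by fun_prop
    rw [lintegral_map hg (by fun_prop), lintegral_withDensity_eq_lintegral_mul _ hf hg',
      lintegral_prod_symm _ (hf.mul hg').aemeasurable, lintegral_prod_symm _ hg.aemeasurable]
    refine lintegral_congr fun y => ?_
    simp only [Pi.mul_apply]
    rw [lintegral_prod _ (by fun_prop)]
    refine lintegral_congr fun x₁ => ?_
    dsimp only
    rw [lintegral_mul_const _ (by fun_prop), hfiber, one_mul]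
  have hmap₁ : μ.map (fun ω => ω.1.1) = γ := by
    have := congrArg (Measure.map Prod.fst) hfst
    rw [Measure.map_map measurable_fst measurable_fst] at this
    simpa [Function.comp_def] using this
  have hmap₂ : μ.map (fun ω => ω.1.2) = γ := by
    have := congrArg (Measure.map Prod.snd) hfst
    rw [Measure.map_map measurable_snd measurable_fst] at this
    simpa [Function.comp_def] using this
  have hindep : IndepFun (fun ω : (ℝ × ℝ) × ℝ => ω.1.1) Prod.snd μ := by
    rw [indepFun_iff_map_prod_eq_prod_map_map (by fun_prop) (by fun_prop), hjoint, hmap₁, hsnd]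
  have hindep' : IndepFun (fun ω : (ℝ × ℝ) × ℝ => ω.1.1) (fun ω => ω.1.2) μ := by
    rw [indepFun_iff_map_prod_eq_prod_map_map (by fun_prop) (by fun_prop), hmap₁, hmap₂]
    exact hfst
  have hγL : MemLp (id : ℝ → ℝ) 2 γ := memLp_id_gaussianReal 2
  have hγsq : ∫ x, x ^ 2 ∂γ = 1 := by
    have h := variance_eq_sub hγL
    rw [variance_id_gaussianReal] at h
    simpa [hγ] using h.symm
  have hL : ∀ T : (ℝ × ℝ) × ℝ → ℝ, Measurable T → μ.map T = γ → MemLp T 2 μ := by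
    intro T hT h
    rw [← h] at hγL
    exact hγL.comp_of_map hT.aemeasurable
  have hsq : ∀ T : (ℝ × ℝ) × ℝ → ℝ, Measurable T → μ.map T = γ → ∫ ω, T ω ^ 2 ∂μ = 1 := by
    intro T hT h
    rw [← hγsq, ← h, integral_map hT.aemeasurable (by fun_prop)]
  have hU := hL (fun ω => ω.1.1) (by fun_prop) hmap₁
  have hV := hL (fun ω => ω.1.2) (by fun_prop) hmap₂
  have hY := hL Prod.snd (by fun_prop) hsnd
  have hVV := hsq (fun ω => ω.1.2) (by fun_prop) hmap₂
  have hYY := hsq Prod.snd (by fun_prop) hsnd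
  have hUV : ∫ ω : (ℝ × ℝ) × ℝ, ω.1.1 * ω.1.2 ∂μ = 0 := by
    have h := hindep'.integral_mul_eq_mul_integral (by fun_prop) (by fun_prop)
    have h0 : ∫ ω : (ℝ × ℝ) × ℝ, ω.1.1 ∂μ = 0 := by
      have := integral_map (μ := μ) (φ := fun ω : (ℝ × ℝ) × ℝ => ω.1.1) (f := fun x : ℝ => x)
        (by fun_prop) (by fun_prop)
      rw [← this, hmap₁]
      exact integral_id_gaussianReal
    rw [h0, zero_mul] at h
    exact h
  have hVYi : Integrable (fun ω : (ℝ × ℝ) × ℝ => ω.1.2 * ω.2) μ := hV.integrable_mul hY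
  have hVY : ∫ ω : (ℝ × ℝ) × ℝ, ω.1.2 * ω.2 ∂μ = √(1 - Real.exp (-2 * κ)) := by
    have hi := (integrable_withDensity_iff_integrable_smul' hf (by simp [hf_def])).1 hVYi
    rw [integral_withDensity_eq_integral_toReal_smul hf (by simp [hf_def]),
      integral_prod_symm _ hi]
    have hin : ∀ y : ℝ, ∫ x : ℝ × ℝ, (f (x, y)).toReal • (x.2 * y) ∂γ.prod γ =
        √(1 - Real.exp (-2 * κ)) * y ^ 2 := by
      intro y
      rw [integral_fun_snd (μ := γ) (ν := γ)
        (fun x : ℝ => (ENNReal.ofReal (Real.exp (gaussianLogDensity κ x y))).toReal • (x * y))]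
      simp only [ENNReal.toReal_ofReal (Real.exp_pos _).le, smul_eq_mul, ← mul_assoc,
        integral_mul_const, hγ, integral_exp_gaussianLogDensity_mul]
      simp
      ring
    simp only [hin, integral_const_mul, hγsq, mul_one]
  let X : (ℝ × ℝ) × ℝ → EuclideanSpace ℝ (Fin 2) := fun ω => !₂[ω.1.1, ω.1.2 / 2]
  let Y : (ℝ × ℝ) × ℝ → EuclideanSpace ℝ (Fin 1) := fun ω => !₂[ω.2]
  have hg : Measurable fun p : ℝ × ℝ => (!₂[p.1, p.2 / 2] : EuclideanSpace ℝ (Fin 2)) := by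
    refine (WithLp.measurable_toLp 2 _).comp (measurable_pi_lambda _ fun i => ?_)
    fin_cases i <;> simp <;> fun_prop
  have hh : Measurable fun y : ℝ => (!₂[y] : EuclideanSpace ℝ (Fin 1)) := by
    refine (WithLp.measurable_toLp 2 _).comp (measurable_pi_lambda _ fun i => ?_)
    fin_cases i; simp; fun_prop
  have hXm : Measurable X := hg.comp measurable_fst
  have hYm : Measurable Y := hh.comp measurable_snd
  let Enc : EuclideanSpace ℝ (Fin 2) →ₗ[ℝ] EuclideanSpace ℝ (Fin 1) :=
    { toFun := fun x => !₂[x 0]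
      map_add' := fun x y => by ext i; fin_cases i; simp
      map_smul' := fun c x => by ext i; fin_cases i; simp }
  let Dec : EuclideanSpace ℝ (Fin 1) →ₗ[ℝ] EuclideanSpace ℝ (Fin 2) :=
    { toFun := fun x => !₂[x 0, 0]
      map_add' := fun x y => by ext i; fin_cases i <;> simp
      map_smul' := fun c x => by ext i; fin_cases i <;> simp }
  refine ⟨2, 1, 1, by norm_num, (ℝ × ℝ) × ℝ, inferInstance, μ, hprob, X, Y, Enc, Dec, hXm, hYm,
    ?_, ?_, ?_, ?_⟩
  · intro h
    have := congrArg (fun x => x 0) (LinearMap.congr_fun h !₂[1, 0])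
    simp [Enc, Dec] at this
  · intro Enc' Dec'
    refine le_trans (le_of_eq ?_) (quarter_le_integral_rank_one_error hU hV
      (hsq _ (by fun_prop) hmap₁) hVV hUV Enc' Dec')
    have : ∀ ω, ‖X ω - Dec (Enc (X ω))‖ ^ 2 = 1 / 4 * ω.1.2 ^ 2 := by
      intro ω
      rw [EuclideanSpace.real_norm_sq_eq]
      simp [X, Enc, Dec, Fin.sum_univ_two]
      ring
    simp only [this, integral_const_mul, hVV, mul_one]
  · let F : EuclideanSpace ℝ (Fin 2) × EuclideanSpace ℝ (Fin 1) → ENNReal :=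
      fun p => ENNReal.ofReal (Real.exp (gaussianLogDensity κ (2 * p.1 1) (p.2 0)))
    have hF : Measurable F := by
      have : Measurable fun p : EuclideanSpace ℝ (Fin 2) × EuclideanSpace ℝ (Fin 1) =>
          gaussianLogDensity κ (2 * p.1 1) (p.2 0) :=
        (measurable_gaussianLogDensity κ).comp (by fun_prop :
          Measurable fun p : EuclideanSpace ℝ (Fin 2) × EuclideanSpace ℝ (Fin 1) =>
            (2 * p.1 1, p.2 0))
      fun_prop
    have hFf : (fun ω => F (X ω, Y ω)) = f := by
      funext ω
      simp only [F, X, Y, hf_def]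
      congr 3
      simp
      ring
    have hmX : μ.map X = π.map X := by
      rw [show X = (fun p : ℝ × ℝ => !₂[p.1, p.2 / 2]) ∘ Prod.fst from rfl,
        ← Measure.map_map hg measurable_fst, ← Measure.map_map hg measurable_fst, hfst]
      simp [hπ]
    have hmY : μ.map Y = π.map Y := by
      rw [show Y = (fun y : ℝ => !₂[y]) ∘ Prod.snd from rfl,
        ← Measure.map_map hh measurable_snd, ← Measure.map_map hh measurable_snd, hsnd]
      simp [hπ]
    have hMI := MI_withDensity (π := π) hXm hYm (indepFun_prod hg hh) hF
      (by rw [hFf]; exact hmX) (by rw [hFf]; exact hmY)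
    simp only [congrFun hFf, ← hμ] at hMI
    rw [hMI]
    have hlog : ∀ ω, Real.log (f ω).toReal = κ + (-(1 - Real.exp (-2 * κ)) /
        (2 * Real.exp (-2 * κ)) * (ω.1.2 ^ 2 + ω.2 ^ 2) +
        √(1 - Real.exp (-2 * κ)) / Real.exp (-2 * κ) * (ω.1.2 * ω.2)) := by
      intro ω
      simp only [hf_def, ENNReal.toReal_ofReal (Real.exp_pos _).le, Real.log_exp]
      unfold gaussianLogDensity
      have h := sq_sqrt_one_sub_exp hκ
      have hv := Real.exp_ne_zero (-2 * κ)
      generalize √(1 - Real.exp (-2 * κ)) = r at *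
      generalize Real.exp (-2 * κ) = v at *
      field_simp
      linear_combination (-ω.2 ^ 2) * h
    have hsum : Integrable (fun ω : (ℝ × ℝ) × ℝ => ω.1.2 ^ 2 + ω.2 ^ 2) μ :=
      hV.integrable_sq.add hY.integrable_sq
    have hsum_val : ∫ ω : (ℝ × ℝ) × ℝ, ω.1.2 ^ 2 + ω.2 ^ 2 ∂μ = 2 := by
      rw [integral_add hV.integrable_sq hY.integrable_sq, hVV, hYY]
      norm_num
    have hquad : Integrable (fun ω : (ℝ × ℝ) × ℝ => -(1 - Real.exp (-2 * κ)) /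
        (2 * Real.exp (-2 * κ)) * (ω.1.2 ^ 2 + ω.2 ^ 2) +
        √(1 - Real.exp (-2 * κ)) / Real.exp (-2 * κ) * (ω.1.2 * ω.2)) μ :=
      (hsum.const_mul _).add (hVYi.const_mul _)
    simp only [hlog]
    rw [integral_add (integrable_const _) hquad,
      integral_add (hsum.const_mul _) (hVYi.const_mul _), integral_const_mul, integral_const_mul,
      hsum_val, hVY]
    have h := sq_sqrt_one_sub_exp hκ
    have hv := Real.exp_ne_zero (-2 * κ)
    simp only [integral_const, probReal_univ, one_smul]
    generalize √(1 - Real.exp (-2 * κ)) = r at *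
    generalize Real.exp (-2 * κ) = v at *
    field_simp
    linear_combination h
  · have hEX : (fun ω => Enc (X ω)) = (fun x : ℝ => !₂[x]) ∘ fun ω : (ℝ × ℝ) × ℝ => ω.1.1 := by
      funext ω
      ext i
      fin_cases i
      simp [Enc, X]
    rw [hEX]
    exact MI_eq_zero_of_indepFun (hh.comp (by fun_prop)) hYm (hindep.comp hh hh)
end

section
/- Let X, Y, Z be random variables and f a function of two arguments such that I(X; Y), I((X, Z); Y) and I(f(X, Z); Y) are defined, and suppose there exists a function g with X = g(f(X, Z)). If the pair (X, Y) and Z are independent, then I(X; Y) = I(f(X, Z); Y). -/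
open MeasureTheory ProbabilityTheory Matrix

/-- Exchanging the last two factors of a triple product preserves the product measure. -/
theorem measurePreserving_prod_right_comm {E F G : Type*} [MeasurableSpace E] [MeasurableSpace F]
    [MeasurableSpace G] (α : Measure E) (β : Measure F) (γ : Measure G)
    [SFinite α] [SFinite β] [SFinite γ] :
    MeasurePreserving (fun p : (E × F) × G => ((p.1.1, p.2), p.1.2))
      ((α.prod β).prod γ) ((α.prod γ).prod β) :=
  ((measurePreserving_prodAssoc α γ β).symm MeasurableEquiv.prodAssoc).comp
    (((MeasurePreserving.id α).prod Measure.measurePreserving_swap).comp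
      (measurePreserving_prodAssoc α β γ))

theorem map_withDensity_comp {E F : Type*} [MeasurableSpace E] [MeasurableSpace F]
    (ν : Measure E) {φ : E → F} (hφ : Measurable φ) {r : F → ENNReal} (hr : Measurable r) :
    (ν.withDensity (r ∘ φ)).map φ = (ν.map φ).withDensity r := by
  ext s hs
  rw [Measure.map_apply hφ hs, withDensity_apply _ (hφ hs), withDensity_apply _ hs,
    setLIntegral_map hs hr hφ]
  rfl

/-- If `X = g (f (X, Z))` and `(X, Y)` is independent of `Z`, then the density of the law of
`(f (X, Z), Y)` with respect to the product of its marginals is that of `(X, Y)`, composed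
with `g` in the first variable. -/
theorem map_denoised_eq_withDensity {Ω E F G H : Type*} [MeasurableSpace Ω] [MeasurableSpace E]
    [MeasurableSpace F] [MeasurableSpace G] [MeasurableSpace H] [MeasurableEq E]
    {μ : Measure Ω} [IsProbabilityMeasure μ] {X : Ω → E} {Y : Ω → F} {Z : Ω → G}
    (hX : Measurable X) (hY : Measurable Y) (hZ : Measurable Z)
    {f : E × G → H} (hf : Measurable f) {g : H → E} (hg : Measurable g)
    (hgf : ∀ ω, g (f (X ω, Z ω)) = X ω)
    (hac : (μ.map fun ω => (X ω, Y ω)) ≪ (μ.map X).prod (μ.map Y))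
    (hindep : IndepFun (fun ω => (X ω, Y ω)) Z μ) :
    (μ.map fun ω => (f (X ω, Z ω), Y ω)) =
      ((μ.map fun ω => f (X ω, Z ω)).prod (μ.map Y)).withDensity fun p =>
        (μ.map fun ω => (X ω, Y ω)).rnDeriv ((μ.map X).prod (μ.map Y)) (g p.1, p.2) := by
  have := Measure.isProbabilityMeasure_map (μ := μ) hX.aemeasurable
  have := Measure.isProbabilityMeasure_map (μ := μ) hY.aemeasurable
  have := Measure.isProbabilityMeasure_map (μ := μ) hZ.aemeasurable
  have hXY := hX.prodMk hY
  have hXZ := hX.prodMk hZ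
  set r := (μ.map fun ω => (X ω, Y ω)).rnDeriv ((μ.map X).prod (μ.map Y))
  have hr : Measurable r := Measure.measurable_rnDeriv _ _
  set T : (E × F) × G → H × F := fun p => (f (p.1.1, p.2), p.1.2) with hT_def
  have hT : Measurable T := by fun_prop
  have hlawXZ : (μ.map fun ω => (X ω, Z ω)) = (μ.map X).prod (μ.map Z) :=
    (indepFun_iff_map_prod_eq_prod_map_map hX.aemeasurable hZ.aemeasurable).1
      (hindep.comp measurable_fst measurable_id)
  have hlaw : (μ.map fun ω => ((X ω, Y ω), Z ω)) =
      (((μ.map X).prod (μ.map Y)).prod (μ.map Z)).withDensity (fun p => r p.1) := by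
    rw [(indepFun_iff_map_prod_eq_prod_map_map hXY.aemeasurable hZ.aemeasurable).1 hindep,
      ← prod_withDensity_left hr, Measure.withDensity_rnDeriv_eq _ _ hac]
  have hcomm := measurePreserving_prod_right_comm (μ.map X) (μ.map Y) (μ.map Z)
  have hmapT : (((μ.map X).prod (μ.map Y)).prod (μ.map Z)).map T =
      (μ.map fun ω => f (X ω, Z ω)).prod (μ.map Y) := by
    have h : T = Prod.map f id ∘ fun p : (E × F) × G => ((p.1.1, p.2), p.1.2) := rfl
    rw [h, ← Measure.map_map (hf.prodMap measurable_id) hcomm.measurable, hcomm.map_eq,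
      ← Measure.map_prod_map _ _ hf measurable_id, Measure.map_id, ← hlawXZ,
      Measure.map_map hf hXZ]
    rfl
  have hgf_ae : ∀ᵐ p ∂(μ.map X).prod (μ.map Z), g (f p) = p.1 := by
    rw [← hlawXZ]
    exact (ae_map_iff hXZ.aemeasurable
      (measurableSet_eq_fun (hg.comp hf) measurable_fst)).2 (.of_forall hgf)
  have hdens : (fun p : (E × F) × G => r p.1) =ᵐ[((μ.map X).prod (μ.map Y)).prod (μ.map Z)]
      (fun p => r (g p.1, p.2)) ∘ T := by
    filter_upwards [hcomm.quasiMeasurePreserving.ae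
      (Measure.quasiMeasurePreserving_fst.ae hgf_ae)] with p hp
    simp only [Function.comp_apply, hT_def, hp]
  calc (μ.map fun ω => (f (X ω, Z ω), Y ω))
      = (μ.map fun ω => ((X ω, Y ω), Z ω)).map T := by
        rw [Measure.map_map hT (hXY.prodMk hZ)]; rfl
    _ = _ := by
        rw [hlaw, withDensity_congr_ae hdens, map_withDensity_comp _ hT (by fun_prop), hmapT]

/-- Let `X`, `Y`, `Z` be random vectors and `f` a function of two
arguments such that `I(X;Y)`, `I((X,Z);Y)` and `I(f(X,Z);Y)` are defined, and suppose
there exists a function `g` with `X = g(f(X,Z))`. If the pair `(X, Y)` and `Z` are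
independent, then `I(X; Y) = I(f(X,Z); Y)`. -/
theorem mi_eq_of_independent_noise_denoising
    {Ω : Type*} [MeasurableSpace Ω] (μ : Measure Ω) [IsProbabilityMeasure μ]
    {dX dY dZ dF : ℕ}
    (X : Ω → Fin dX → ℝ) (Y : Ω → Fin dY → ℝ) (Z : Ω → Fin dZ → ℝ)
    (hX : Measurable X) (hY : Measurable Y) (hZ : Measurable Z)
    (f : (Fin dX → ℝ) × (Fin dZ → ℝ) → (Fin dF → ℝ)) (hf : Measurable f)
    (g : (Fin dF → ℝ) → (Fin dX → ℝ)) (hg : Measurable g)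
    -- `X = g(f(X, Z))`:
    (hgf : ∀ ω, g (f (X ω, Z ω)) = X ω)
    -- the relevant mutual informations are defined:
    (hIXY : MIDefined μ X Y)
    (hIXZY : MIDefined μ (fun ω => (X ω, Z ω)) Y)
    (hIfY : MIDefined μ (fun ω => f (X ω, Z ω)) Y)
    -- the pair `(X, Y)` and `Z` are independent:
    (hindep : IndepFun (fun ω => (X ω, Y ω)) Z μ) :
    MI μ X Y = MI μ (fun ω => f (X ω, Z ω)) Y := by
  have := Measure.isProbabilityMeasure_map (μ := μ) hY.aemeasurable
  have hW : Measurable fun ω => f (X ω, Z ω) := hf.comp (hX.prodMk hZ)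
  have := Measure.isProbabilityMeasure_map (μ := μ) hW.aemeasurable
  have hr := Measure.measurable_rnDeriv (μ.map fun ω => (X ω, Y ω)) ((μ.map X).prod (μ.map Y))
  have hdens := map_denoised_eq_withDensity hX hY hZ hf hg hgf hIXY.1 hindep
  have hrn := Measure.rnDeriv_withDensity
    ((μ.map fun ω => f (X ω, Z ω)).prod (μ.map Y))
    (hr.comp ((hg.comp measurable_fst).prodMk measurable_snd))
  have hlog : Measurable fun p => Real.log ((μ.map fun ω => (X ω, Y ω)).rnDeriv
      ((μ.map X).prod (μ.map Y)) p).toReal := hr.ennreal_toReal.log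
  unfold MI
  rw [integral_map (hX.prodMk hY).aemeasurable hlog.aestronglyMeasurable]
  have hrn_joint : (μ.map fun ω => (f (X ω, Z ω), Y ω)).rnDeriv
      ((μ.map fun ω => f (X ω, Z ω)).prod (μ.map Y))
      =ᵐ[μ.map fun ω => (f (X ω, Z ω), Y ω)] fun p => (μ.map fun ω => (X ω, Y ω)).rnDeriv
        ((μ.map X).prod (μ.map Y)) (g p.1, p.2) := by
    refine hIfY.1.ae_le ?_
    rw [hdens]
    exact hrn
  rw [integral_congr_ae (hrn_joint.mono fun p hp => congrArg (fun t => Real.log t.toReal) hp)]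
  refine Eq.trans ?_ (integral_map (hW.prodMk hY).aemeasurable
    (hlog.comp ((hg.comp measurable_fst).prodMk measurable_snd)).aestronglyMeasurable).symm
  simp only [Function.comp_apply, hgf]
end
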